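/- arXiv:quant-ph/0104072 — 2 statements merged into one kernel-verified Lean document; each statement's English description precedes it below -/
import Mathlib

section
/- Let N_a, N_b > 0 and K_x ≥ |K_p| be real numbers, let θ ∈ [0, π/2), and set c = cos θ, s = sin θ, ν = s²·N_b + c², D_x = N_a·N_b - K_x². Define the 2×2 matrices Ã = (1/ν)·diag(c²·N_a + s²·D_x, c²·N_a + s²·N_a·N_b), B̃ = (1/ν)·diag(N_b, (c²·N_b + s²)·ν), C̃ = (1/ν)·diag(c·K_x, c·K_p·ν), and let γ̃ be the 4×4 symmetric matrix with diagonal blocks Ã, B̃ and off-diagonal block C̃. Let A = N_a·I₂, B = N_b·I₂, C = diag(K_x, K_p) and γ the corresponding 4×4 matrix. Then det γ̃ + 1 < det Ã + det B̃ - 2·det C̃ holds if and only if det γ + 1 < det A + det B - 2·det C holds. -/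
open Real Matrix

/-- The block `Ã` of the Wigner correlation matrix after the beam-splitter +
homodyne measurement symmetrization step. -/
noncomputable def tilA (Na Nb Kx θ : ℝ) : Matrix (Fin 2) (Fin 2) ℝ :=
  (1 / (Real.sin θ ^ 2 * Nb + Real.cos θ ^ 2)) •
    !![Real.cos θ ^ 2 * Na + Real.sin θ ^ 2 * (Na * Nb - Kx ^ 2), 0;
       0, Real.cos θ ^ 2 * Na + Real.sin θ ^ 2 * (Na * Nb)]

/-- The block `B̃`. -/
noncomputable def tilB (Nb θ : ℝ) : Matrix (Fin 2) (Fin 2) ℝ :=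
  (1 / (Real.sin θ ^ 2 * Nb + Real.cos θ ^ 2)) •
    !![Nb, 0;
       0, (Real.cos θ ^ 2 * Nb + Real.sin θ ^ 2) * (Real.sin θ ^ 2 * Nb + Real.cos θ ^ 2)]

/-- The block `C̃`. -/
noncomputable def tilC (Nb Kx Kp θ : ℝ) : Matrix (Fin 2) (Fin 2) ℝ :=
  (1 / (Real.sin θ ^ 2 * Nb + Real.cos θ ^ 2)) •
    !![Real.cos θ * Kx, 0;
       0, Real.cos θ * Kp * (Real.sin θ ^ 2 * Nb + Real.cos θ ^ 2)]

/-- The full 4×4 Wigner correlation matrix `γ̃` with diagonal blocks `Ã`, `B̃` and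
off-diagonal block `C̃`. -/
noncomputable def gammaTilde (Na Nb Kx Kp θ : ℝ) : Matrix (Fin 2 ⊕ Fin 2) (Fin 2 ⊕ Fin 2) ℝ :=
  Matrix.fromBlocks (tilA Na Nb Kx θ) (tilC Nb Kx Kp θ) (tilC Nb Kx Kp θ)ᵀ (tilB Nb θ)

/-- The original Wigner correlation matrix `γ` in standard form, with diagonal blocks
`A = N_a·I₂`, `B = N_b·I₂` and off-diagonal block `C = diag(K_x, K_p)`. -/
noncomputable def gammaStd (Na Nb Kx Kp : ℝ) : Matrix (Fin 2 ⊕ Fin 2) (Fin 2 ⊕ Fin 2) ℝ :=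
  Matrix.fromBlocks (Na • (1 : Matrix (Fin 2) (Fin 2) ℝ)) !![Kx, 0; 0, Kp]
    (!![Kx, 0; 0, Kp])ᵀ (Nb • (1 : Matrix (Fin 2) (Fin 2) ℝ))

/-- Determinant of a two-mode matrix all of whose 2×2 blocks are diagonal. -/
lemma det_diag_blocks (a1 a2 b1 b2 c1 c2 : ℝ) :
    (Matrix.fromBlocks !![a1, 0; 0, a2] !![c1, 0; 0, c2] !![c1, 0; 0, c2]
      !![b1, 0; 0, b2]).det = (a1 * b1 - c1 ^ 2) * (a2 * b2 - c2 ^ 2) := by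
  rw [← Matrix.det_submatrix_equiv_self (finSumFinEquiv (m := 2) (n := 2)).symm]
  have h : (Matrix.fromBlocks !![a1, 0; 0, a2] !![c1, 0; 0, c2] !![c1, 0; 0, c2]
      !![b1, 0; 0, b2]).submatrix (finSumFinEquiv (m := 2) (n := 2)).symm
        (finSumFinEquiv (m := 2) (n := 2)).symm =
      (!![a1, 0, c1, 0; 0, a2, 0, c2; c1, 0, b1, 0; 0, c2, 0, b2] :
        Matrix (Fin 4) (Fin 4) ℝ) := by
    ext i j
    fin_cases i <;> fin_cases j <;> rfl
  rw [h]
  simp [Matrix.det_succ_row_zero, Fin.sum_univ_succ, Fin.succAbove]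
  ring

theorem stmt9 (Na Nb Kx Kp θ : ℝ) (hNa : 0 < Na) (hNb : 0 < Nb) (hK : |Kp| ≤ Kx)
    (hθ : θ ∈ Set.Ico (0 : ℝ) (Real.pi / 2)) :
    ((gammaTilde Na Nb Kx Kp θ).det + 1 <
        (tilA Na Nb Kx θ).det + (tilB Nb θ).det - 2 * (tilC Nb Kx Kp θ).det) ↔
      ((gammaStd Na Nb Kx Kp).det + 1 <
        (Na • (1 : Matrix (Fin 2) (Fin 2) ℝ)).det + (Nb • (1 : Matrix (Fin 2) (Fin 2) ℝ)).det
          - 2 * (!![Kx, 0; 0, Kp] : Matrix (Fin 2) (Fin 2) ℝ).det) := by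
  have hc : 0 < Real.cos θ :=
    Real.cos_pos_of_mem_Ioo ⟨by linarith [hθ.1, Real.pi_pos], hθ.2⟩
  have hs : Real.sin θ ^ 2 = 1 - Real.cos θ ^ 2 := Real.sin_sq θ
  have hν : 0 < Real.sin θ ^ 2 * Nb + Real.cos θ ^ 2 := by positivity
  have hone : ∀ x : ℝ, x • (1 : Matrix (Fin 2) (Fin 2) ℝ) = !![x, 0; 0, x] := by
    intro x
    ext i j
    fin_cases i <;> fin_cases j <;> simp
  have htr : ∀ x y : ℝ, (!![x, 0; 0, y] : Matrix (Fin 2) (Fin 2) ℝ)ᵀ = !![x, 0; 0, y] := by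
    intro x y
    ext i j
    fin_cases i <;> fin_cases j <;> rfl
  have hsm : ∀ r x y : ℝ, r • (!![x, 0; 0, y] : Matrix (Fin 2) (Fin 2) ℝ)
      = !![r * x, 0; 0, r * y] := by
    intro r x y
    ext i j
    fin_cases i <;> fin_cases j <;> simp
  simp only [gammaTilde, gammaStd, tilA, tilB, tilC, hone, hsm, htr, det_diag_blocks,
    Matrix.det_fin_two_of]
  generalize Real.cos θ = c at *
  generalize Real.sin θ = s at *
  rw [← sub_pos, ← sub_pos (b := _ + 1) (a := Na * Na - _ + _ - _)]
  have hpos : 0 < c ^ 2 / (s ^ 2 * Nb + c ^ 2) := by positivity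
  refine Iff.trans ?_ (mul_pos_iff_of_pos_left hpos)
  apply iff_of_eq
  congr 1
  field_simp
  ring
end

section
/- Let N, M ≥ 1 and let γ be a real symmetric positive definite matrix of size 2(N+M). Let J = J_{N+M} and J̃ = J_N ⊕ (-J_M). Suppose γ + i·J is positive semidefinite (as a complex Hermitian matrix) but γ + i·J̃ is not positive semidefinite. Then there exist real symplectic matrices S_A ∈ Sp(2N, ℝ) and S_B ∈ Sp(2M, ℝ) such that, letting γ̂ = (S_A ⊕ S_B)ᵀ · γ · (S_A ⊕ S_B) and letting γ_red be the 4×4 principal submatrix of γ̂ on the rows and columns with indices {1, 2, 2N+1, 2N+2}, the matrix γ_red + i·J₂ is positive semidefinite but γ_red + i·(J₁ ⊕ (-J₁)) is not positive semidefinite. -/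
open Matrix Complex
open scoped ComplexOrder

/-- The standard symplectic form `J_n`: block-diagonal with `n` copies of
`J₁ = !![0,-1;1,0]`. -/
noncomputable def Jmat (n : ℕ) : Matrix (Fin (2 * n)) (Fin (2 * n)) ℝ :=
  Matrix.of fun i j =>
    if (j : ℕ) = (i : ℕ) + 1 ∧ (i : ℕ) % 2 = 0 then -1
    else if (i : ℕ) = (j : ℕ) + 1 ∧ (j : ℕ) % 2 = 0 then 1 else 0

/-- Direct sum (block diagonal) of two square matrices. -/
noncomputable def dsum {a b : ℕ} (A : Matrix (Fin a) (Fin a) ℝ) (B : Matrix (Fin b) (Fin b) ℝ) :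
    Matrix (Fin (a + b)) (Fin (a + b)) ℝ :=
  Matrix.reindex finSumFinEquiv finSumFinEquiv (Matrix.fromBlocks A 0 0 B)

/-- The 4×4 standard symplectic form `J₂ = J₁ ⊕ J₁`. -/
noncomputable def J2 : Matrix (Fin 4) (Fin 4) ℝ :=
  !![0, -1, 0, 0;
     1, 0, 0, 0;
     0, 0, 0, -1;
     0, 0, 1, 0]

/-- The 4×4 partially transposed symplectic form `J₁ ⊕ (-J₁)`. -/
noncomputable def J2tilde : Matrix (Fin 4) (Fin 4) ℝ :=
  !![0, -1, 0, 0;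
     1, 0, 0, 0;
     0, 0, 0, 1;
     0, 0, -1, 0]

/-- The indices `{1, 2, 2N+1, 2N+2}` (zero-based: `0, 1, 2N, 2N+1`) selecting the first
mode of each party. -/
def idx4 (N M : ℕ) (hN : 1 ≤ N) (hM : 1 ≤ M) : Fin 4 → Fin (2 * N + 2 * M) :=
  ![⟨0, by omega⟩, ⟨1, by omega⟩, ⟨2 * N, by omega⟩, ⟨2 * N + 1, by omega⟩]

lemma sp_step {V : Type*} [AddCommGroup V] [Module ℝ V] (ω : V →ₗ[ℝ] V →ₗ[ℝ] ℝ)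
    (hω : ∀ x y, ω x y = - ω y x) (u u' : V) (h : ω u u' ≠ 0) :
    ∃ f : V →ₗ[ℝ] V, (∀ x y, ω (f x) (f y) = ω x y) ∧ f u = u' ∧
      ∀ x, ω x u = ω x u' → f x = x := by
  have h0 : ∀ x, ω x x = 0 := fun x => by linarith [hω x x]
  refine ⟨LinearMap.id + (ω u u')⁻¹ • (ω.flip (u' - u)).smulRight (u' - u), ?_, ?_, ?_⟩
  · intro x y
    have e1 := hω (u' - u) y
    have e2 := h0 (u' - u)
    simp only [LinearMap.add_apply, LinearMap.id_apply, LinearMap.smul_apply,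
      LinearMap.smulRight_apply, LinearMap.flip_apply, map_add, map_smul, smul_eq_mul, e1, e2]
    ring
  · simp [h0, smul_smul, h]
  · intro x hx
    simp [hx]

lemma sp_pair {V : Type*} [AddCommGroup V] [Module ℝ V] (ω : V →ₗ[ℝ] V →ₗ[ℝ] ℝ)
    (hω : ∀ x y, ω x y = - ω y x) (e e' u v : V) (h1 : ω e e' = -1) (h2 : ω u v = -1) :
    ∃ f : V →ₗ[ℝ] V, (∀ x y, ω (f x) (f y) = ω x y) ∧ f e = u ∧ f e' = v := by
  have h0 : ∀ x, ω x x = 0 := fun x => by linarith [hω x x]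
  have ht : ∃ t, ω e t ≠ 0 ∧ ω u t ≠ 0 := by
    by_cases c1 : ω u e' = 0
    · by_cases c2 : ω e v = 0
      · refine ⟨e' + v, ?_, ?_⟩ <;> simp [c1, c2, h1, h2]
      · exact ⟨v, c2, by simp [h2]⟩
    · exact ⟨e', by simp [h1], c1⟩
  obtain ⟨t, ht1, ht2⟩ := ht
  obtain ⟨f, hf, hfe, -⟩ := sp_step ω hω e t ht1
  obtain ⟨g, hg, hge, -⟩ := sp_step ω hω t u (by rw [hω]; simpa using ht2)
  have hw : ω u (g (f e')) = -1 := by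
    rw [← hge, ← hfe, hg, hf, h1]
  have hk : ∃ k : V →ₗ[ℝ] V, (∀ x y, ω (k x) (k y) = ω x y) ∧ k u = u ∧ k (g (f e')) = v := by
    generalize g (f e') = w at hw
    by_cases c : ω w v = 0
    · obtain ⟨k, hk, hk1, hk2⟩ := sp_step ω hω w (u + v) (by
        rw [map_add, c, hω w u, hw]; norm_num)
      obtain ⟨l, hl, hl1, hl2⟩ := sp_step ω hω (u + v) v (by
        simp [h0, h2])
      refine ⟨l ∘ₗ k, fun x y => by simp [hl, hk], ?_, by simp [hk1, hl1]⟩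
      have a1 : k u = u := hk2 u (by simp [h0, h2, hw])
      have a2 : l u = u := hl2 u (by simp [h0])
      simp [a1, a2]
    · obtain ⟨k, hk, hk1, hk2⟩ := sp_step ω hω w v c
      exact ⟨k, hk, hk2 u (by rw [hw, h2]), hk1⟩
  obtain ⟨k, hk, hk1, hk2⟩ := hk
  exact ⟨k ∘ₗ g ∘ₗ f, fun x y => by simp [hk, hg, hf], by simp [hfe, hge, hk1], by simp [hk2]⟩

lemma Jmat_transpose (n : ℕ) : (Jmat n)ᵀ = - Jmat n := by
  ext i j
  simp only [Jmat, transpose_apply, of_apply, Matrix.neg_apply]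
  split_ifs <;> first | omega | simp

lemma bil_symm {n : Type*} [Fintype n] (G : Matrix n n ℝ) (hG : Gᵀ = G) (x y : n → ℝ) :
    x ⬝ᵥ G *ᵥ y = y ⬝ᵥ G *ᵥ x := by
  rw [dotProduct_mulVec, ← mulVec_transpose, hG, dotProduct_comm]

lemma bil_anti {n : Type*} [Fintype n] (G : Matrix n n ℝ) (hG : Gᵀ = -G) (x y : n → ℝ) :
    x ⬝ᵥ G *ᵥ y = - (y ⬝ᵥ G *ᵥ x) := by
  rw [dotProduct_mulVec, ← mulVec_transpose, hG, dotProduct_comm, neg_mulVec, dotProduct_neg]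

lemma sp_matrix (n : ℕ) (hn : 1 ≤ n) (u v : Fin (2 * n) → ℝ) (h : u ⬝ᵥ Jmat n *ᵥ v = -1) :
    ∃ S : Matrix (Fin (2 * n)) (Fin (2 * n)) ℝ, Sᵀ * Jmat n * S = Jmat n ∧
      (∀ i, S i ⟨0, by omega⟩ = u i) ∧ (∀ i, S i ⟨1, by omega⟩ = v i) := by
  let ω : (Fin (2 * n) → ℝ) →ₗ[ℝ] (Fin (2 * n) → ℝ) →ₗ[ℝ] ℝ :=
    Matrix.toLinearMap₂' ℝ (Jmat n)
  have hω : ∀ x y, ω x y = x ⬝ᵥ Jmat n *ᵥ y := fun x y => Matrix.toLinearMap₂'_apply' _ _ _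
  obtain ⟨f, hf, h1, h2⟩ := sp_pair ω
    (fun x y => by rw [hω, hω]; exact bil_anti _ (Jmat_transpose n) x y)
    (Pi.single ⟨0, by omega⟩ 1) (Pi.single ⟨1, by omega⟩ 1) u v
    (by rw [hω]; simp [Jmat]) (by rw [hω, h])
  refine ⟨LinearMap.toMatrix' f, ?_, ?_, ?_⟩
  · ext i j
    have := hf (Pi.single i 1) (Pi.single j 1)
    rw [hω, hω] at this
    simp only [single_one_dotProduct, mulVec_single_one, col_apply] at this
    rw [← this, Matrix.mul_assoc, Matrix.mul_apply]
    simp only [dotProduct, transpose_apply, LinearMap.toMatrix'_apply, Matrix.mul_apply, mulVec]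
  · intro i; rw [LinearMap.toMatrix'_apply, h1]
  · intro i; rw [LinearMap.toMatrix'_apply, h2]

lemma psd_iff {n : Type*} [Fintype n] (G J : Matrix n n ℝ) (hG : Gᵀ = G) (hJ : Jᵀ = -J) :
    (G.map Complex.ofReal + Complex.I • J.map Complex.ofReal).PosSemidef ↔
    ∀ x y : n → ℝ, 0 ≤ x ⬝ᵥ G *ᵥ x + y ⬝ᵥ G *ᵥ y - 2 * (x ⬝ᵥ J *ᵥ y) := by
  have key : ∀ x y : n → ℝ,
      star ((fun i => (x i : ℂ)) + Complex.I • (fun i => (y i : ℂ))) ⬝ᵥ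
        (G.map Complex.ofReal + Complex.I • J.map Complex.ofReal) *ᵥ
          ((fun i => (x i : ℂ)) + Complex.I • (fun i => (y i : ℂ))) =
      ((x ⬝ᵥ G *ᵥ x + y ⬝ᵥ G *ᵥ y - 2 * (x ⬝ᵥ J *ᵥ y) : ℝ) : ℂ) := by
    intro x y
    have hm : ∀ (A : Matrix n n ℝ) (x y : n → ℝ),
        (fun i => (x i : ℂ)) ⬝ᵥ A.map Complex.ofReal *ᵥ (fun i => (y i : ℂ)) =
          ((x ⬝ᵥ A *ᵥ y : ℝ) : ℂ) := by
      intro A x y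
      simp [dotProduct, mulVec]
    have hs : ∀ x : n → ℝ, star (fun i => (x i : ℂ)) = fun i => (x i : ℂ) := by
      intro x; ext i; simp
    have e1 := bil_symm G hG y x
    have e2 := bil_anti J hJ y x
    have e3 : x ⬝ᵥ J *ᵥ x = 0 := by linarith [bil_anti J hJ x x]
    have e4 : y ⬝ᵥ J *ᵥ y = 0 := by linarith [bil_anti J hJ y y]
    simp only [star_add, star_smul, hs, add_dotProduct, smul_dotProduct, add_mulVec, mulVec_add,
      mulVec_smul, smul_mulVec, dotProduct_add, dotProduct_smul, hm, e1, e2, e3, e4, smul_eq_mul]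
    simp only [Complex.star_def, Complex.conj_I]
    push_cast
    linear_combination (-(y ⬝ᵥ G *ᵥ y : ℝ) + 2 * (x ⬝ᵥ J *ᵥ y : ℝ) : ℂ) * Complex.I_mul_I
  rw [posSemidef_iff_dotProduct_mulVec]
  constructor
  · rintro ⟨-, h⟩ x y
    have := h ((fun i => (x i : ℂ)) + Complex.I • (fun i => (y i : ℂ)))
    rw [key] at this
    exact_mod_cast this
  · intro h
    refine ⟨?_, ?_⟩
    · ext i j
      have h1 := congrFun (congrFun hG i) j
      have h2 := congrFun (congrFun hJ i) j
      simp only [transpose_apply, Matrix.neg_apply] at h1 h2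
      simp [h1, h2]
    · intro z
      have hz : z = (fun i => ((z i).re : ℂ)) + Complex.I • (fun i => ((z i).im : ℂ)) := by
        ext i
        simp [mul_comm Complex.I, Complex.re_add_im]
      rw [hz, key]
      exact_mod_cast h _ _

lemma dsum_bil {a b : ℕ} (A : Matrix (Fin a) (Fin a) ℝ) (B : Matrix (Fin b) (Fin b) ℝ)
    (x y : Fin (a + b) → ℝ) :
    x ⬝ᵥ dsum A B *ᵥ y =
      (fun i => x (Fin.castAdd b i)) ⬝ᵥ A *ᵥ (fun i => y (Fin.castAdd b i)) +
      (fun i => x (Fin.natAdd a i)) ⬝ᵥ B *ᵥ (fun i => y (Fin.natAdd a i)) := by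
  simp [dotProduct, mulVec, Fin.sum_univ_add, dsum]

lemma dsum_transpose {a b : ℕ} (A : Matrix (Fin a) (Fin a) ℝ) (B : Matrix (Fin b) (Fin b) ℝ) :
    (dsum A B)ᵀ = dsum Aᵀ Bᵀ := by
  simp [dsum, fromBlocks_transpose]

lemma dsum_neg {a b : ℕ} (A : Matrix (Fin a) (Fin a) ℝ) (B : Matrix (Fin b) (Fin b) ℝ) :
    -(dsum A B) = dsum (-A) (-B) := by
  ext i j
  refine Fin.addCases (fun i => ?_) (fun i => ?_) i <;>
  refine Fin.addCases (fun j => ?_) (fun j => ?_) j <;> simp [dsum]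

lemma dsum_mul {a b : ℕ} (A A' : Matrix (Fin a) (Fin a) ℝ) (B B' : Matrix (Fin b) (Fin b) ℝ) :
    dsum A B * dsum A' B' = dsum (A * A') (B * B') := by
  simp [dsum, submatrix_mul_equiv, fromBlocks_multiply]

lemma dsum_ll {a b : ℕ} (A : Matrix (Fin a) (Fin a) ℝ) (B : Matrix (Fin b) (Fin b) ℝ) (i j) :
    dsum A B (Fin.castAdd b i) (Fin.castAdd b j) = A i j := by simp [dsum]

lemma dsum_lr {a b : ℕ} (A : Matrix (Fin a) (Fin a) ℝ) (B : Matrix (Fin b) (Fin b) ℝ) (i j) :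
    dsum A B (Fin.castAdd b i) (Fin.natAdd a j) = 0 := by simp [dsum]

lemma dsum_rl {a b : ℕ} (A : Matrix (Fin a) (Fin a) ℝ) (B : Matrix (Fin b) (Fin b) ℝ) (i j) :
    dsum A B (Fin.natAdd a i) (Fin.castAdd b j) = 0 := by simp [dsum]

lemma dsum_rr {a b : ℕ} (A : Matrix (Fin a) (Fin a) ℝ) (B : Matrix (Fin b) (Fin b) ℝ) (i j) :
    dsum A B (Fin.natAdd a i) (Fin.natAdd a j) = B i j := by simp [dsum]

lemma idx4_J2 (N M : ℕ) (hN : 1 ≤ N) (hM : 1 ≤ M) :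
    (dsum (Jmat N) (Jmat M)).submatrix (idx4 N M hN hM) (idx4 N M hN hM) = J2 := by
  have h0 : idx4 N M hN hM 0 = Fin.castAdd _ ⟨0, by omega⟩ := rfl
  have h1 : idx4 N M hN hM 1 = Fin.castAdd _ ⟨1, by omega⟩ := rfl
  have h2 : idx4 N M hN hM 2 = Fin.natAdd _ ⟨0, by omega⟩ := rfl
  have h3 : idx4 N M hN hM 3 = Fin.natAdd _ ⟨1, by omega⟩ := rfl
  ext i j
  rw [submatrix_apply]
  fin_cases i <;> fin_cases j <;>
    simp only [Fin.zero_eta, Fin.mk_one, Fin.reduceFinMk, h0, h1, h2, h3, dsum_ll, dsum_lr,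
      dsum_rl, dsum_rr] <;> simp [Jmat, J2]

lemma idx4_J2tilde (N M : ℕ) (hN : 1 ≤ N) (hM : 1 ≤ M) :
    (dsum (Jmat N) (-Jmat M)).submatrix (idx4 N M hN hM) (idx4 N M hN hM) = J2tilde := by
  have h0 : idx4 N M hN hM 0 = Fin.castAdd _ ⟨0, by omega⟩ := rfl
  have h1 : idx4 N M hN hM 1 = Fin.castAdd _ ⟨1, by omega⟩ := rfl
  have h2 : idx4 N M hN hM 2 = Fin.natAdd _ ⟨0, by omega⟩ := rfl
  have h3 : idx4 N M hN hM 3 = Fin.natAdd _ ⟨1, by omega⟩ := rfl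
  ext i j
  rw [submatrix_apply]
  fin_cases i <;> fin_cases j <;>
    simp only [Fin.zero_eta, Fin.mk_one, Fin.reduceFinMk, h0, h1, h2, h3, dsum_ll, dsum_lr,
      dsum_rl, dsum_rr] <;> simp [Jmat, J2tilde]

lemma bil_sub {n m : Type*} [Fintype n] [Fintype m] (T G : Matrix n n ℝ) (f : m → n)
    (x y : m → ℝ) :
    x ⬝ᵥ (Tᵀ * G * T).submatrix f f *ᵥ y =
      (T.submatrix id f *ᵥ x) ⬝ᵥ G *ᵥ (T.submatrix id f *ᵥ y) := by
  have : (Tᵀ * G * T).submatrix f f = (T.submatrix id f)ᵀ * G * T.submatrix id f := by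
    ext i j; simp [Matrix.mul_apply]
  rw [this, ← mulVec_mulVec, ← mulVec_mulVec, dotProduct_mulVec, vecMul_transpose]

theorem stmt12 (N M : ℕ) (hN : 1 ≤ N) (hM : 1 ≤ M)
    (γ : Matrix (Fin (2 * N + 2 * M)) (Fin (2 * N + 2 * M)) ℝ)
    (hsym : γ.IsSymm) (hpd : γ.PosDef)
    (hphys : (γ.map (Complex.ofReal) +
        Complex.I • (dsum (Jmat N) (Jmat M)).map (Complex.ofReal)).PosSemidef)
    (hnpt : ¬ (γ.map (Complex.ofReal) +
        Complex.I • (dsum (Jmat N) (-(Jmat M))).map (Complex.ofReal)).PosSemidef) :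
    ∃ (SA : Matrix (Fin (2 * N)) (Fin (2 * N)) ℝ) (SB : Matrix (Fin (2 * M)) (Fin (2 * M)) ℝ),
      SAᵀ * Jmat N * SA = Jmat N ∧ SBᵀ * Jmat M * SB = Jmat M ∧
      ((Matrix.of fun i j =>
          ((dsum SA SB)ᵀ * γ * dsum SA SB) (idx4 N M hN hM i) (idx4 N M hN hM j) :
          Matrix (Fin 4) (Fin 4) ℝ).map (Complex.ofReal)
        + Complex.I • J2.map (Complex.ofReal)).PosSemidef ∧
      ¬ ((Matrix.of fun i j =>
          ((dsum SA SB)ᵀ * γ * dsum SA SB) (idx4 N M hN hM i) (idx4 N M hN hM j) :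
          Matrix (Fin 4) (Fin 4) ℝ).map (Complex.ofReal)
        + Complex.I • J2tilde.map (Complex.ofReal)).PosSemidef := by
  have hG : γᵀ = γ := hsym
  have hJ : (dsum (Jmat N) (Jmat M))ᵀ = -dsum (Jmat N) (Jmat M) := by
    rw [dsum_transpose, dsum_neg, Jmat_transpose, Jmat_transpose]
  have hJt : (dsum (Jmat N) (-Jmat M))ᵀ = -dsum (Jmat N) (-Jmat M) := by
    rw [dsum_transpose, dsum_neg, transpose_neg, Jmat_transpose, Jmat_transpose]
  rw [psd_iff _ _ hG hJ] at hphys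
  rw [psd_iff _ _ hG hJt] at hnpt
  push Not at hnpt
  obtain ⟨x, y, hxy⟩ := hnpt
  have p1 := hphys x y
  have p2 := hphys y x
  have hxy' := hxy
  rw [dsum_bil] at hxy' p1 p2
  rw [bil_anti _ (Jmat_transpose N), bil_anti _ (Jmat_transpose M)] at p2
  rw [neg_mulVec, dotProduct_neg] at hxy'
  set xA := fun i => x (Fin.castAdd (2 * M) i) with hxA
  set yA := fun i => y (Fin.castAdd (2 * M) i) with hyA
  set xB := fun i => x (Fin.natAdd (2 * N) i) with hxB
  set yB := fun i => y (Fin.natAdd (2 * N) i) with hyB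
  obtain ⟨a, ha⟩ : ∃ a, a = xA ⬝ᵥ Jmat N *ᵥ yA := ⟨_, rfl⟩
  obtain ⟨b, hb⟩ : ∃ b, b = - (xB ⬝ᵥ Jmat M *ᵥ yB) := ⟨_, rfl⟩
  have ha0 : 0 < a := by linarith
  have hb0 : 0 < b := by linarith
  have hsa := Real.sqrt_pos.2 ha0
  have hsb := Real.sqrt_pos.2 hb0
  have hsa2 := Real.mul_self_sqrt ha0.le
  have hsb2 := Real.mul_self_sqrt hb0.le
  obtain ⟨SA, hSA, hA0, hA1⟩ := sp_matrix N hN ((√a)⁻¹ • yA) ((√a)⁻¹ • xA) (by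
    rw [mulVec_smul, smul_dotProduct, dotProduct_smul, bil_anti _ (Jmat_transpose N), ← ha]
    simp only [smul_eq_mul]
    field_simp
    nlinarith)
  obtain ⟨SB, hSB, hB0, hB1⟩ := sp_matrix M hM ((√b)⁻¹ • xB) ((√b)⁻¹ • yB) (by
    have hb' : xB ⬝ᵥ Jmat M *ᵥ yB = -b := by linarith
    rw [mulVec_smul, smul_dotProduct, dotProduct_smul, hb']
    simp only [smul_eq_mul]
    field_simp
    nlinarith)
  refine ⟨SA, SB, hSA, hSB, ?_⟩
  set T := dsum SA SB with hT
  set f := idx4 N M hN hM with hf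
  have hTJ : Tᵀ * dsum (Jmat N) (Jmat M) * T = dsum (Jmat N) (Jmat M) := by
    rw [hT, dsum_transpose, dsum_mul, dsum_mul, hSA, hSB]
  have hTJt : Tᵀ * dsum (Jmat N) (-Jmat M) * T = dsum (Jmat N) (-Jmat M) := by
    rw [hT, dsum_transpose, dsum_mul, dsum_mul, hSA, Matrix.mul_neg, Matrix.neg_mul, hSB]
  have hred : (Matrix.of fun i j => (Tᵀ * γ * T) (f i) (f j) : Matrix (Fin 4) (Fin 4) ℝ)
      = (Tᵀ * γ * T).submatrix f f := rfl
  have hredS : ((Tᵀ * γ * T).submatrix f f)ᵀ = (Tᵀ * γ * T).submatrix f f := by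
    rw [transpose_submatrix, transpose_mul, transpose_mul, transpose_transpose, hG,
      Matrix.mul_assoc]
  rw [hred, ← idx4_J2 N M hN hM, ← idx4_J2tilde N M hN hM, ← hf]
  rw [psd_iff _ _ hredS (by rw [transpose_submatrix, hJ]; rfl),
    psd_iff _ _ hredS (by rw [transpose_submatrix, hJt]; rfl)]
  rw [← hTJ, ← hTJt]
  simp only [bil_sub]
  refine ⟨fun _ _ => hphys _ _, ?_⟩
  push Not
  have h0 : f 0 = Fin.castAdd _ ⟨0, by omega⟩ := rfl
  have h1 : f 1 = Fin.castAdd _ ⟨1, by omega⟩ := rfl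
  have h2 : f 2 = Fin.natAdd _ ⟨0, by omega⟩ := rfl
  have h3 : f 3 = Fin.natAdd _ ⟨1, by omega⟩ := rfl
  have hx : T.submatrix id f *ᵥ ![0, √a, √b, 0] = x := by
    ext i
    refine Fin.addCases (fun i => ?_) (fun i => ?_) i <;>
      simp only [mulVec, dotProduct, Fin.sum_univ_four, submatrix_apply, id, h0, h1, h2, h3, hT,
        dsum_ll, dsum_lr, dsum_rl, dsum_rr, hA0, hA1, hB0, hB1] <;>
      simp [hxA, hyA, hxB, hyB] <;> field_simp
  have hy : T.submatrix id f *ᵥ ![√a, 0, 0, √b] = y := by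
    ext i
    refine Fin.addCases (fun i => ?_) (fun i => ?_) i <;>
      simp only [mulVec, dotProduct, Fin.sum_univ_four, submatrix_apply, id, h0, h1, h2, h3, hT,
        dsum_ll, dsum_lr, dsum_rl, dsum_rr, hA0, hA1, hB0, hB1] <;>
      simp [hxA, hyA, hxB, hyB] <;> field_simp
  refine ⟨![0, √a, √b, 0], ![√a, 0, 0, √b], ?_⟩
  rw [hx, hy]
  exact hxy
end
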